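/- arXiv:2410.16837 — 2 statements merged into one kernel-verified Lean document; each statement's English description precedes it below -/
import Mathlib

section
/- Lemma 4.2 (equivalence of the confinement condition and the classical Signorini condition under the Kirchhoff–Love assumptions, the latter rendered as affine dependence of the deformation on the transverse variable). Let ω ⊂ ℝ² be nonempty, bounded and open, let ε > 0, let q ∈ E³, and let Φ : (closure ω) × [−ε, ε] → E³ be continuous and affine in the transverse variable, i.e. Φ(y, x₃) = ((ε − x₃)/(2ε)) • Φ(y, −ε) + ((ε + x₃)/(2ε)) • Φ(y, ε) for every (y, x₃) ∈ (closure ω) × [−ε, ε]. Then the following two conditions are equivalent: (i) the confinement condition: Φ(y, x₃) · q ≥ 0 for Lebesgue-almost every (y, x₃) ∈ ω × (−ε, ε); (ii) the Signorini condition: Φ(y, x₃) · q ≥ 0 for every (y, x₃) ∈ (closure ω) × {−ε, ε}. -/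
open MeasureTheory
open scoped RealInnerProductSpace

/-- Lemma 4.2: under the Kirchhoff–Love assumptions (rendered as affine
dependence of the deformed configuration `Φ` on the transverse variable), the
confinement condition `Φ·q ≥ 0` a.e. in the open plate `ω × (−ε, ε)` is
equivalent to the classical Signorini condition `Φ·q ≥ 0` on the upper and
lower faces `(closure ω) × {−ε, ε}`. -/
theorem confinement_iff_signorini
    (ω : Set (EuclideanSpace ℝ (Fin 2))) (hne : ω.Nonempty)
    (hbd : Bornology.IsBounded ω) (hop : IsOpen ω)
    (ε : ℝ) (hε : 0 < ε) (q : EuclideanSpace ℝ (Fin 3))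
    (Φ : EuclideanSpace ℝ (Fin 2) × ℝ → EuclideanSpace ℝ (Fin 3))
    (hcont : ContinuousOn Φ (closure ω ×ˢ Set.Icc (-ε) ε))
    (haff : ∀ y ∈ closure ω, ∀ x₃ ∈ Set.Icc (-ε) ε,
      Φ (y, x₃) = ((ε - x₃) / (2 * ε)) • Φ (y, -ε)
        + ((ε + x₃) / (2 * ε)) • Φ (y, ε)) :
    (∀ᵐ p ∂(volume : Measure (EuclideanSpace ℝ (Fin 2) × ℝ)),
        p ∈ ω ×ˢ Set.Ioo (-ε) ε → 0 ≤ ⟪Φ p, q⟫)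
      ↔ (∀ p ∈ closure ω ×ˢ ({-ε, ε} : Set ℝ), 0 ≤ ⟪Φ p, q⟫) := by
  have hcl : closure (ω ×ˢ Set.Ioo (-ε) ε) = closure ω ×ˢ Set.Icc (-ε) ε := by
    rw [closure_prod_eq, closure_Ioo (by linarith)]
  have hf : ContinuousOn (fun p => ⟪Φ p, q⟫) (closure ω ×ˢ Set.Icc (-ε) ε) :=
    hcont.inner continuousOn_const
  have hU : IsOpen (ω ×ˢ Set.Ioo (-ε) ε) := hop.prod isOpen_Ioo
  constructor
  · intro h
    have hB : IsOpen ((ω ×ˢ Set.Ioo (-ε) ε) ∩ (fun p => ⟪Φ p, q⟫) ⁻¹' Set.Iio 0) :=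
      (hf.mono (hcl ▸ subset_closure)).isOpen_inter_preimage hU isOpen_Iio
    have h0 : (volume : Measure (EuclideanSpace ℝ (Fin 2) × ℝ))
        ((ω ×ˢ Set.Ioo (-ε) ε) ∩ (fun p => ⟪Φ p, q⟫) ⁻¹' Set.Iio 0) = 0 := by
      refine measure_mono_null ?_ (ae_iff.1 h)
      rintro p ⟨hp, hp'⟩ hc
      exact absurd (hc hp) (not_le.2 hp')
    have hE := (hB.measure_eq_zero_iff _).1 h0
    have hpos : ∀ p ∈ ω ×ˢ Set.Ioo (-ε) ε, 0 ≤ ⟪Φ p, q⟫ := by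
      intro p hp
      by_contra hc
      have : p ∈ (∅ : Set (EuclideanSpace ℝ (Fin 2) × ℝ)) := hE ▸ ⟨hp, not_le.1 hc⟩
      exact this
    rintro ⟨y, t⟩ ⟨hy, ht⟩
    have hmem : (y, t) ∈ closure (ω ×ˢ Set.Ioo (-ε) ε) := by
      rw [hcl]
      refine ⟨hy, ?_⟩
      rcases ht with ht | ht
      · simp only at ht
        subst ht
        exact ⟨le_rfl, by linarith⟩
      · have ht' : t = ε := ht
        subst ht'
        exact ⟨by show -t ≤ t; linarith, le_rfl⟩
    exact le_on_closure (f := fun _ => (0 : ℝ)) hpos continuousOn_const (hcl.symm ▸ hf) hmem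
  · intro h
    refine Filter.Eventually.of_forall ?_
    rintro ⟨y, t⟩ ⟨hy, ht1, ht2⟩
    simp only at hy ht1 ht2
    have hy' := subset_closure hy
    rw [haff y hy' t ⟨ht1.le, ht2.le⟩, inner_add_left, real_inner_smul_left,
      real_inner_smul_left]
    have h1 := h (y, -ε) ⟨hy', by simp⟩
    have h2 := h (y, ε) ⟨hy', by simp⟩
    have a1 : 0 ≤ (ε - t) / (2 * ε) := div_nonneg (by linarith) (by linarith)
    have a2 : 0 ≤ (ε + t) / (2 * ε) := div_nonneg (by linarith) (by linarith)
    exact add_nonneg (mul_nonneg a1 h1) (mul_nonneg a2 h2)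
end

section
/- Uniform positive-definiteness of the contravariant elasticity tensor (the inequality asserted in Lemma 4.1 of the paper): let K be a nonempty compact topological space, let λ ≥ 0 and μ > 0 be real numbers, and let G : K → Matrix (Fin 3) (Fin 3) ℝ be continuous, such that G(x) is a symmetric positive-definite matrix for every x ∈ K. For x ∈ K define A^{ijkl}(x) := λ G(x)ᵢⱼ G(x)ₖₗ + μ (G(x)ᵢₖ G(x)ⱼₗ + G(x)ᵢₗ G(x)ⱼₖ). Then there exists a constant C₀ > 0 such that for every x ∈ K and every symmetric real 3×3 matrix t = (tᵢⱼ), Σ_{i,j} tᵢⱼ² ≤ C₀ · Σ_{i,j,k,l} A^{ijkl}(x) t_{kl} t_{ij}. -/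
open Matrix in
lemma frob_mul_aux (X Y : Matrix (Fin 3) (Fin 3) ℝ) :
    ∑ i, ∑ j, ((X * Y) i j) ^ 2 ≤ (∑ i, ∑ j, (X i j) ^ 2) * ∑ i, ∑ j, (Y i j) ^ 2 := by
  rw [Finset.sum_comm (f := fun i j => (Y i j) ^ 2), Finset.sum_mul_sum]
  refine Finset.sum_le_sum fun i _ => Finset.sum_le_sum fun j _ => ?_
  rw [Matrix.mul_apply]
  exact Finset.sum_mul_sq_le_sq_mul_sq _ _ _

open Matrix in
lemma frob_trace_aux (X : Matrix (Fin 3) (Fin 3) ℝ) :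
    ∑ i, ∑ j, (X i j) ^ 2 = (X * Xᵀ).trace := by
  simp [Matrix.trace, Matrix.mul_apply, pow_two]

open Matrix in
open scoped MatrixOrder Matrix.Norms.L2Operator in
lemma point_aux (G t : Matrix (Fin 3) (Fin 3) ℝ) (hG : G.PosDef) (ht : t.IsSymm) :
    ∑ i, ∑ j, (t i j) ^ 2 ≤ (G⁻¹).trace ^ 2 * (G * t * G * t).trace := by
  obtain ⟨B, hB⟩ := CStarAlgebra.nonneg_iff_eq_star_mul_self.mp hG.posSemidef.nonneg
  rw [Matrix.star_eq_conjTranspose, Matrix.conjTranspose_eq_transpose_of_trivial] at hB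
  have hd : IsUnit B.det := by
    have := hG.det_pos
    rw [hB, Matrix.det_mul, Matrix.det_transpose] at this
    exact isUnit_iff_ne_zero.mpr (fun h => by simp [h] at this)
  have hdT : IsUnit Bᵀ.det := by rwa [Matrix.det_transpose]
  have e : t = B⁻¹ * (B * t * Bᵀ) * (B⁻¹)ᵀ := by
    rw [Matrix.transpose_nonsing_inv, Matrix.mul_assoc B, Matrix.nonsing_inv_mul_cancel_left _ _ hd,
      Matrix.mul_nonsing_inv_cancel_right _ _ hdT]
  have e1 : ∑ i, ∑ j, (B⁻¹ i j) ^ 2 = (G⁻¹).trace := by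
    rw [frob_trace_aux, hB, Matrix.mul_inv_rev, Matrix.transpose_nonsing_inv]
  have e2 : ∑ i, ∑ j, ((B⁻¹)ᵀ i j) ^ 2 = (G⁻¹).trace := by
    rw [← e1, Finset.sum_comm]; rfl
  have e3 : ∑ i, ∑ j, ((B * t * Bᵀ) i j) ^ 2 = (G * t * G * t).trace := by
    rw [frob_trace_aux, hB]
    simp only [Matrix.transpose_mul, Matrix.transpose_transpose, ht.eq, Matrix.mul_assoc]
    rw [Matrix.trace_mul_comm Bᵀ]
    simp only [Matrix.mul_assoc]
  have h0 : 0 ≤ (G⁻¹).trace := by rw [← e1]; positivity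
  have h1 := frob_mul_aux (B⁻¹ * (B * t * Bᵀ)) (B⁻¹)ᵀ
  have h2 := frob_mul_aux B⁻¹ (B * t * Bᵀ)
  rw [← e, e2] at h1
  rw [e1, e3] at h2
  nlinarith [mul_le_mul_of_nonneg_right h2 h0]

open Matrix in
lemma form_aux (lam mu : ℝ) (G t : Matrix (Fin 3) (Fin 3) ℝ) (hG : G.IsSymm) (ht : t.IsSymm) :
    ∑ i, ∑ j, ∑ k, ∑ l, (lam * G i j * G k l + mu * (G i k * G j l + G i l * G j k))
      * t k l * t i j = lam * (∑ i, ∑ j, G i j * t i j) ^ 2 + 2 * mu * (G * t * G * t).trace := by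
  have a := hG.apply 0 1
  have b := hG.apply 0 2
  have c := hG.apply 1 2
  have a' := ht.apply 0 1
  have b' := ht.apply 0 2
  have c' := ht.apply 1 2
  simp only [Matrix.trace, Matrix.diag, Matrix.mul_apply, Fin.sum_univ_three, a, b, c, a', b', c']
  ring

/-- Lemma 4.1 of the paper: uniform positive-definiteness of the contravariant
elasticity tensor `A^{ijkl} = λ gⁱʲ gᵏˡ + μ (gⁱᵏ gʲˡ + gⁱˡ gʲᵏ)` built from a
continuous family of symmetric positive-definite matrices on a compact set. -/
theorem elasticity_tensor_uniformly_positive_definite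
    (K : Type*) [TopologicalSpace K] [CompactSpace K] [Nonempty K]
    (lam mu : ℝ) (hlam : 0 ≤ lam) (hmu : 0 < mu)
    (G : K → Matrix (Fin 3) (Fin 3) ℝ) (hGcont : Continuous G)
    (hGsymm : ∀ x, (G x).IsSymm) (hGpos : ∀ x, (G x).PosDef)
    (A : K → Fin 3 → Fin 3 → Fin 3 → Fin 3 → ℝ)
    (hA : ∀ x i j k l, A x i j k l =
      lam * G x i j * G x k l + mu * (G x i k * G x j l + G x i l * G x j k)) :
    ∃ C₀ : ℝ, 0 < C₀ ∧
      ∀ x : K, ∀ t : Matrix (Fin 3) (Fin 3) ℝ, t.IsSymm →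
        ∑ i, ∑ j, (t i j) ^ 2
          ≤ C₀ * ∑ i, ∑ j, ∑ k, ∑ l, A x i j k l * t k l * t i j := by
  have hc : Continuous fun x => ((G x)⁻¹).trace := by
    have : (fun x => ((G x)⁻¹).trace) = fun x => ((G x).det)⁻¹ * (G x).adjugate.trace := by
      funext x
      simp [Matrix.inv_def, Matrix.trace_smul]
    rw [this]
    exact (hGcont.matrix_det.inv₀ fun x => (hGpos x).det_pos.ne').mul
      hGcont.matrix_adjugate.matrix_trace
  obtain ⟨M, hM⟩ := isCompact_univ.exists_bound_of_continuousOn hc.continuousOn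
  refine ⟨(M ^ 2 + 1) / (2 * mu), by positivity, fun x t ht => ?_⟩
  simp only [hA]
  rw [form_aux lam mu (G x) t (hGsymm x) ht]
  have h := point_aux (G x) t (hGpos x) ht
  have hb : ((G x)⁻¹).trace ^ 2 ≤ M ^ 2 := by
    have := hM x (Set.mem_univ x)
    rw [Real.norm_eq_abs] at this
    exact sq_le_sq' (abs_le.mp this).1 (abs_le.mp this).2
  have hq : 0 ≤ (G x * t * G x * t).trace := by
    by_contra hn
    push Not at hn
    have hs : 0 ≤ ∑ i, ∑ j, (t i j) ^ 2 := by positivity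
    have hp : 0 < ((G x)⁻¹).trace ^ 2 := by
      have := (hGpos x).inv.trace_pos
      positivity
    nlinarith [mul_neg_of_pos_of_neg hp hn]
  set q := (G x * t * G x * t).trace
  set S := ∑ i, ∑ j, G x i j * t i j
  have e : (M ^ 2 + 1) / (2 * mu) * (lam * S ^ 2 + 2 * mu * q)
      = (M ^ 2 + 1) / (2 * mu) * (lam * S ^ 2) + (M ^ 2 + 1) * q := by
    field_simp
  rw [e]
  have : 0 ≤ (M ^ 2 + 1) / (2 * mu) * (lam * S ^ 2) := by positivity
  nlinarith [mul_le_mul_of_nonneg_right hb hq]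
end
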